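/- There exists a real number z with 1.35 < z < 1.36 satisfying the transcendental equation z² − 4·cos²(zπ/2) − sin²(zπ/2) = 0. -/

import Mathlib

open Real

theorem sin_mul_pi_lt : sin (0.175 * π) < 0.5236 := by
  have hlo := pi_gt_d4
  have hhi := pi_lt_d4
  have hx : |0.175 * π| ≤ 1 := by rw [abs_of_pos (by positivity)]; linarith
  have hb := (abs_le.1 (sin_bound hx)).2
  rw [abs_of_pos (by positivity)] at hb
  have h3 : (0.5497 : ℝ) ^ 3 ≤ (0.175 * π) ^ 3 := by gcongr; linarith
  have h5 : (0.175 * π) ^ 5 ≤ (0.5498 : ℝ) ^ 5 := by gcongr; linarith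
  norm_num at h3 h5 hb ⊢
  linarith

theorem lt_sin_mul_pi : 0.5325 < sin (0.18 * π) := by
  have hlo := pi_gt_d4
  have hhi := pi_lt_d4
  have hb := sin_gt_sub_cube (x := 0.18 * π) (by positivity)
  have h3 : (0.18 * π) ^ 3 ≤ (0.5655 : ℝ) ^ 3 := by gcongr; linarith
  norm_num at h3 hb ⊢
  linarith

theorem sq_sub_cos_sq_sub_sin_sq_eq (z : ℝ) :
    z ^ 2 - 4 * cos (z * π / 2) ^ 2 - sin (z * π / 2) ^ 2 =
      z ^ 2 - 1 - 3 * sin ((z - 1) / 2 * π) ^ 2 := by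
  rw [show z * π / 2 = (z - 1) / 2 * π + π / 2 by ring, cos_add_pi_div_two, sin_add_pi_div_two,
    cos_sq']
  ring

/-- Existence of the root `z₀ ≈ 1.352317` of the transcendental equation
`z² − 4cos²(zπ/2) − sin²(zπ/2) = 0` from Remark A.2. -/
theorem stmt_4 :
    ∃ z : ℝ, 1.35 < z ∧ z < 1.36 ∧
      z ^ 2 - 4 * Real.cos (z * π / 2) ^ 2 - Real.sin (z * π / 2) ^ 2 = 0 := by
  simp only [sq_sub_cos_sq_sub_sin_sq_eq]
  have hcont : ContinuousOn (fun z : ℝ => z ^ 2 - 1 - 3 * sin ((z - 1) / 2 * π) ^ 2)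
      (Set.Icc 1.35 1.36) := by fun_prop
  have hl := sin_mul_pi_lt
  have hr := lt_sin_mul_pi
  have hpos : 0 < sin (0.175 * π) :=
    sin_pos_of_pos_of_lt_pi (by positivity) (by linarith [pi_pos])
  have hneg : (1.36 : ℝ) ^ 2 - 1 - 3 * sin ((1.36 - 1) / 2 * π) ^ 2 < 0 := by
    rw [show ((1.36 : ℝ) - 1) / 2 = 0.18 by norm_num]
    nlinarith
  have hgt : 0 < (1.35 : ℝ) ^ 2 - 1 - 3 * sin ((1.35 - 1) / 2 * π) ^ 2 := by
    rw [show ((1.35 : ℝ) - 1) / 2 = 0.175 by norm_num]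
    nlinarith
  obtain ⟨z, ⟨h₁, h₂⟩, hz⟩ := intermediate_value_Ioo' (by norm_num) hcont ⟨hneg, hgt⟩
  exact ⟨z, h₁, h₂, hz⟩
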